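/- For every κ > 0 there exists a constant C(κ) > 0 such that for all smooth compactly supported maps u₂ : ℝ² → ℝ² and θ : ℝ² → ℝ², |Σ_{i,k=1}^{2} ∫_{ℝ²} u₂_i(x) ∂_i θ_k(x) Δθ_k(x) dx| ≤ κ ‖Δθ‖₂² + C(κ) ‖u₂‖₂² ‖∇u₂‖₂² ‖∇θ‖₂², where Δθ_k = ∂₁₁θ_k + ∂₂₂θ_k. -/

import Mathlib

open MeasureTheory

noncomputable section

/-- Partial derivative of a real-valued function on `ℝ²` in the `i`-th coordinate direction. -/
def pderivE (g : (Fin 2 → ℝ) → ℝ) (i : Fin 2) (x : Fin 2 → ℝ) : ℝ :=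
  fderiv ℝ g x (Pi.single i 1)

/-- The Navier–Stokes trilinear form
`b(u,v,w) = ∑ i j, ∫ u_i ∂_i v_j w_j`. -/
def formB (u v w : (Fin 2 → ℝ) → (Fin 2 → ℝ)) : ℝ :=
  ∑ i : Fin 2, ∑ j : Fin 2, ∫ x : Fin 2 → ℝ, u x i * pderivE (fun y => v y j) i x * w x j

/-- The Ericksen stress trilinear form
`m(θ₁,θ₂,u) = −∑ i j k, ∫ ∂_i θ₁^k ∂_j θ₂^k ∂_j u^i`. -/
def formM (t1 t2 u : (Fin 2 → ℝ) → (Fin 2 → ℝ)) : ℝ :=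
  -∑ i : Fin 2, ∑ j : Fin 2, ∑ k : Fin 2, ∫ x : Fin 2 → ℝ,
    pderivE (fun y => t1 y k) i x * pderivE (fun y => t2 y k) j x *
      pderivE (fun y => u y i) j x

/-- `u` is divergence-free: `∂₁u₁ + ∂₂u₂ = 0` everywhere. -/
def DivergenceFree (u : (Fin 2 → ℝ) → (Fin 2 → ℝ)) : Prop :=
  ∀ x, (∑ i : Fin 2, pderivE (fun y => u y i) i x) = 0

/-- The `L²` norm of an `ℝ²`-valued map. -/
def l2norm (g : (Fin 2 → ℝ) → (Fin 2 → ℝ)) : ℝ :=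
  (∫ x : Fin 2 → ℝ, ∑ k : Fin 2, (g x k) ^ 2) ^ (1/2 : ℝ)

/-- The `L²` norm of the gradient of an `ℝ²`-valued map. -/
def gradNorm (g : (Fin 2 → ℝ) → (Fin 2 → ℝ)) : ℝ :=
  (∫ x : Fin 2 → ℝ, ∑ i : Fin 2, ∑ k : Fin 2, (pderivE (fun y => g y k) i x) ^ 2) ^ (1/2 : ℝ)

/-- The `L²` norm of a real-valued function. -/
def l2normR (g : (Fin 2 → ℝ) → ℝ) : ℝ :=
  (∫ x : Fin 2 → ℝ, (g x) ^ 2) ^ (1/2 : ℝ)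

/-- The `L²` norm of the gradient of a real-valued function. -/
def gradNormR (g : (Fin 2 → ℝ) → ℝ) : ℝ :=
  (∫ x : Fin 2 → ℝ, ∑ i : Fin 2, (pderivE g i x) ^ 2) ^ (1/2 : ℝ)

/-- The `k`-th component of the (componentwise) Laplacian `Δg_k = ∂₁₁ g_k + ∂₂₂ g_k`. -/
def lapComp (g : (Fin 2 → ℝ) → (Fin 2 → ℝ)) (k : Fin 2) (x : Fin 2 → ℝ) : ℝ :=
  ∑ i : Fin 2, pderivE (pderivE (fun y => g y k) i) i x

/-- The `L²` norm of the componentwise Laplacian. -/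
def lapNorm (g : (Fin 2 → ℝ) → (Fin 2 → ℝ)) : ℝ :=
  (∫ x : Fin 2 → ℝ, ∑ k : Fin 2, (lapComp g k x) ^ 2) ^ (1/2 : ℝ)

/-- The `L^{4N+2}` norm of an `ℝ²`-valued map (written using `|v|^{4N+2} = (|v|²)^{2N+1}`). -/
def lqNorm (N : ℕ) (g : (Fin 2 → ℝ) → (Fin 2 → ℝ)) : ℝ :=
  (∫ x : Fin 2 → ℝ, (∑ k : Fin 2, (g x k) ^ 2) ^ (2 * N + 1)) ^ (1 / (4 * (N:ℝ) + 2))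

/-- The polynomial nonlinearity `f(θ) = (∑_{j=0}^{N} b_j |θ|^{2j}) θ`. -/
def polyF (N : ℕ) (b : Fin (N + 1) → ℝ) (v : Fin 2 → ℝ) : Fin 2 → ℝ :=
  fun k => (∑ j : Fin (N + 1), b j * (∑ l : Fin 2, (v l) ^ 2) ^ (j : ℕ)) * v k

/-- Smooth compactly supported real-valued functions on `ℝ²`. -/
structure IsTestFunction (f : (Fin 2 → ℝ) → ℝ) : Prop where
  contDiff : ContDiff ℝ (⊤ : ℕ∞) f
  hasCompactSupport : HasCompactSupport f

namespace IsTestFunction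

variable {f g : (Fin 2 → ℝ) → ℝ}

lemma partialDeriv (hf : IsTestFunction f) (i : Fin 2) : IsTestFunction (pderivE f i) where
  contDiff := (hf.contDiff.fderiv_right (m := (⊤ : ℕ∞)) (by simp)).clm_apply contDiff_const
  hasCompactSupport := hf.hasCompactSupport.fderiv_apply ℝ _

lemma mul (hf : IsTestFunction f) (hg : IsTestFunction g) :
    IsTestFunction (fun x => f x * g x) where
  contDiff := hf.contDiff.mul hg.contDiff
  hasCompactSupport := hf.hasCompactSupport.mul_right

lemma sq (hf : IsTestFunction f) : IsTestFunction (fun x => f x ^ 2) := by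
  simpa only [pow_two] using hf.mul hf

lemma add (hf : IsTestFunction f) (hg : IsTestFunction g) :
    IsTestFunction (fun x => f x + g x) where
  contDiff := hf.contDiff.add hg.contDiff
  hasCompactSupport := hf.hasCompactSupport.add hg.hasCompactSupport

lemma continuous (hf : IsTestFunction f) : Continuous f := hf.contDiff.continuous

lemma integrable (hf : IsTestFunction f) : Integrable f :=
  hf.continuous.integrable_of_hasCompactSupport hf.hasCompactSupport

lemma differentiable (hf : IsTestFunction f) : Differentiable ℝ f :=
  hf.contDiff.differentiable (by simp)

lemma component {v : (Fin 2 → ℝ) → (Fin 2 → ℝ)} (hv : ContDiff ℝ (⊤ : ℕ∞) v)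
    (hv' : HasCompactSupport v) (k : Fin 2) : IsTestFunction (fun x => v x k) where
  contDiff := contDiff_pi.1 hv k
  hasCompactSupport := hv'.comp_left (g := fun y : Fin 2 → ℝ => y k) rfl

lemma integral_mul_pderivE (hf : IsTestFunction f) (hg : IsTestFunction g) (i : Fin 2) :
    ∫ x, f x * pderivE g i x = -∫ x, pderivE f i x * g x :=
  integral_mul_fderiv_eq_neg_fderiv_mul_of_integrable ((hf.partialDeriv i).mul hg).integrable
    (hf.mul (hg.partialDeriv i)).integrable (hf.mul hg).integrable
    (fun x _ => hf.differentiable x) (fun x _ => hg.differentiable x)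

lemma pderivE_comm (hf : IsTestFunction f) (i j : Fin 2) :
    pderivE (pderivE f i) j = pderivE (pderivE f j) i := by
  have hd : Differentiable ℝ (fderiv ℝ f) :=
    (hf.contDiff.fderiv_right (m := 1) (by norm_cast)).differentiable one_ne_zero
  have key : ∀ (k l : Fin 2) (x : Fin 2 → ℝ), pderivE (pderivE f k) l x =
      fderiv ℝ (fderiv ℝ f) x (Pi.single l 1) (Pi.single k 1) := by
    intro k l x
    have h := (hd x).hasFDerivAt.clm_apply
      (hasFDerivAt_const (Pi.single k (1 : ℝ) : Fin 2 → ℝ) x)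
    change fderiv ℝ (fun y => fderiv ℝ f y (Pi.single k 1)) x (Pi.single l 1) = _
    rw [h.fderiv]
    simp
  funext x
  rw [key, key]
  exact (hf.contDiff.contDiffAt.isSymmSndFDerivAt (by
    rw [minSmoothness_of_isRCLikeNormedField]; exact WithTop.coe_le_coe.2 le_top)) _ _

lemma integral_sq_pderivE_pderivE (hf : IsTestFunction f) (i j : Fin 2) :
    ∫ x, pderivE (pderivE f i) j x ^ 2 =
      ∫ x, pderivE (pderivE f i) i x * pderivE (pderivE f j) j x := by
  have hij : pderivE (pderivE (pderivE f i) j) j =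
      pderivE (pderivE (pderivE f j) j) i := by
    rw [hf.pderivE_comm i j, (hf.partialDeriv j).pderivE_comm i j]
  have h₁ := ((hf.partialDeriv i).partialDeriv j).integral_mul_pderivE (hf.partialDeriv i) j
  have h₂ := ((hf.partialDeriv j).partialDeriv j).integral_mul_pderivE (hf.partialDeriv i) i
  rw [hij, ← h₂] at h₁
  simp only [pow_two]
  rw [h₁]
  exact integral_congr_ae (.of_forall fun x => mul_comm _ _)

/-- The `L²` norm of the Hessian equals the `L²` norm of the Laplacian. -/
lemma sum_integral_sq_pderivE_pderivE (hf : IsTestFunction f) :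
    ∑ i : Fin 2, ∑ j : Fin 2, ∫ x, pderivE (pderivE f i) j x ^ 2 =
      ∫ x, (∑ i : Fin 2, pderivE (pderivE f i) i x) ^ 2 := by
  have hI : ∀ i j : Fin 2, Integrable fun x =>
      pderivE (pderivE f i) i x * pderivE (pderivE f j) j x :=
    fun i j => (((hf.partialDeriv i).partialDeriv i).mul ((hf.partialDeriv j).partialDeriv j)).integrable
  simp only [hf.integral_sq_pderivE_pderivE]
  simp only [pow_two, Finset.sum_mul_sum]
  rw [integral_finsetSum _ fun i _ => integrable_finsetSum _ fun j _ => hI i j]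
  exact Finset.sum_congr rfl fun i _ => (integral_finsetSum _ fun j _ => hI i j).symm

end IsTestFunction

/-- The Cauchy–Schwarz inequality for integrals of real-valued functions. -/
lemma sq_integral_mul_le {α : Type*} [MeasurableSpace α] {μ : Measure α} {f g : α → ℝ}
    (hf : Integrable (fun x => f x ^ 2) μ) (hg : Integrable (fun x => g x ^ 2) μ)
    (hfg : Integrable (fun x => f x * g x) μ) :
    (∫ x, f x * g x ∂μ) ^ 2 ≤ (∫ x, f x ^ 2 ∂μ) * ∫ x, g x ^ 2 ∂μ := by
  have h : ∀ t : ℝ, 0 ≤ (∫ x, g x ^ 2 ∂μ) * (t * t) + (2 * ∫ x, f x * g x ∂μ) * t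
      + ∫ x, f x ^ 2 ∂μ := by
    intro t
    have h₀ : 0 ≤ ∫ x, (f x + t * g x) ^ 2 ∂μ := integral_nonneg fun x => sq_nonneg _
    have h₁ : ∫ x, (f x + t * g x) ^ 2 ∂μ =
        ∫ x, (t * t) * g x ^ 2 + 2 * t * (f x * g x) + f x ^ 2 ∂μ := by
      congr 1; ext x; ring
    have h₂ : Integrable (fun x => t * t * g x ^ 2 + 2 * t * (f x * g x)) μ :=
      (hg.const_mul _).add (hfg.const_mul _)
    rw [h₁, integral_add h₂ hf,
      integral_add (hg.const_mul _) (hfg.const_mul _), integral_const_mul,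
      integral_const_mul] at h₀
    linarith
  have := discrim_le_zero h
  rw [discrim] at this
  linarith

lemma norm_fderiv_le_sum_abs_pderivE (f : (Fin 2 → ℝ) → ℝ) (x : Fin 2 → ℝ) :
    ‖fderiv ℝ f x‖ ≤ ∑ i : Fin 2, |pderivE f i x| := by
  refine ContinuousLinearMap.opNorm_le_bound _ (by positivity) fun v => ?_
  have hv : v = ∑ i : Fin 2, v i • (Pi.single i (1 : ℝ) : Fin 2 → ℝ) := by
    rw [← pi_eq_sum_univ' v]
  conv_lhs => rw [hv]
  rw [map_sum, Finset.sum_mul]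
  refine (norm_sum_le _ _).trans (Finset.sum_le_sum fun i _ => ?_)
  rw [map_smul, norm_smul, mul_comm]
  exact mul_le_mul_of_nonneg_left (norm_le_pi_norm v i) (abs_nonneg _)

/-- The planar Gagliardo–Nirenberg–Sobolev inequality, in terms of real integrals. -/
lemma IsTestFunction.integral_sq_le {f : (Fin 2 → ℝ) → ℝ} (hf : IsTestFunction f) :
    ∫ x, f x ^ 2 ≤ (∫ x, ‖fderiv ℝ f x‖) ^ 2 := by
  have hc : (Real.HolderConjugate (Fintype.card (Fin 2)) 2) := by
    simpa using Real.HolderConjugate.two_two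
  have h := lintegral_pow_le_pow_lintegral_fderiv_aux hc (hf.contDiff.of_le (by norm_cast))
    hf.hasCompactSupport
  have hI : Integrable (fun x => fderiv ℝ f x) :=
    (hf.contDiff.continuous_fderiv (by simp)).integrable_of_hasCompactSupport
      (hf.hasCompactSupport.fderiv ℝ)
  rw [integral_norm_eq_lintegral_enorm hI.1, integral_eq_lintegral_of_nonneg_ae
    (.of_forall fun x => sq_nonneg _) hf.sq.continuous.aestronglyMeasurable, ← ENNReal.toReal_pow]
  refine ENNReal.toReal_mono (ENNReal.pow_ne_top hI.2.ne) ?_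
  simp only [ENNReal.rpow_two] at h
  refine le_trans (le_of_eq ?_) h
  congr 1; ext x
  rw [← ofReal_norm, ← ENNReal.ofReal_pow (norm_nonneg _), Real.norm_eq_abs, sq_abs]

/-- The **Ladyzhenskaya inequality** in the plane. -/
lemma IsTestFunction.integral_pow_four_le {f : (Fin 2 → ℝ) → ℝ} (hf : IsTestFunction f) :
    ∫ x, (f x ^ 2) ^ 2 ≤
      8 * ((∫ x, f x ^ 2) * ∑ i : Fin 2, ∫ x, pderivE f i x ^ 2) := by
  have hcont : ∀ i, Continuous (pderivE f i) := fun i => (hf.partialDeriv i).continuous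
  set s : (Fin 2 → ℝ) → ℝ := fun x => ∑ i : Fin 2, |pderivE f i x| with hs
  have hs_cont : Continuous s := continuous_finsetSum _ fun i _ => (hcont i).abs
  have hs_sq : ∀ x, s x ^ 2 ≤ 2 * ∑ i : Fin 2, pderivE f i x ^ 2 := by
    intro x
    simp only [hs, Fin.sum_univ_two]
    nlinarith [sq_nonneg (|pderivE f 0 x| - |pderivE f 1 x|), sq_abs (pderivE f 0 x),
      sq_abs (pderivE f 1 x)]
  have hgrad : Integrable fun x => 2 * ∑ i : Fin 2, pderivE f i x ^ 2 :=
    (integrable_finsetSum _ fun i _ => (hf.partialDeriv i).sq.integrable).const_mul 2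
  have hs_int : Integrable fun x => s x ^ 2 := by
    refine hgrad.mono' (hs_cont.pow 2).aestronglyMeasurable (.of_forall fun x => ?_)
    rw [Real.norm_of_nonneg (sq_nonneg _)]
    exact hs_sq x
  have hfs_int : Integrable fun x => |f x| * s x :=
    (hf.continuous.abs.mul hs_cont).integrable_of_hasCompactSupport
      (hf.hasCompactSupport.norm.mul_right)
  have hderiv : ∀ x, ‖fderiv ℝ (fun y => f y ^ 2) x‖ ≤ 2 * (|f x| * s x) := by
    intro x
    rw [fderiv_fun_pow 2 (hf.differentiable x), norm_smul]
    simp only [Nat.add_one_sub_one, pow_one, nsmul_eq_mul, Nat.cast_ofNat, norm_mul,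
      Real.norm_eq_abs, abs_two, mul_assoc]
    gcongr
    exact norm_fderiv_le_sum_abs_pderivE f x
  calc ∫ x, (f x ^ 2) ^ 2 ≤ (∫ x, ‖fderiv ℝ (fun y => f y ^ 2) x‖) ^ 2 := hf.sq.integral_sq_le
    _ ≤ (∫ x, 2 * (|f x| * s x)) ^ 2 := by
      refine pow_le_pow_left₀ (integral_nonneg fun x => norm_nonneg _) ?_ 2
      exact integral_mono_of_nonneg (.of_forall fun x => norm_nonneg _) (hfs_int.const_mul 2)
        (.of_forall hderiv)
    _ = 4 * (∫ x, |f x| * s x) ^ 2 := by rw [integral_const_mul]; ring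
    _ ≤ 4 * ((∫ x, |f x| ^ 2) * ∫ x, s x ^ 2) := by
      gcongr
      exact sq_integral_mul_le (by simpa only [sq_abs] using hf.sq.integrable) hs_int hfs_int
    _ ≤ 4 * ((∫ x, f x ^ 2) * ∫ x, 2 * ∑ i : Fin 2, pderivE f i x ^ 2) := by
      simp only [sq_abs]
      refine mul_le_mul_of_nonneg_left (mul_le_mul_of_nonneg_left
        (integral_mono hs_int hgrad hs_sq) (integral_nonneg fun x => sq_nonneg _)) (by norm_num)
    _ = 8 * ((∫ x, f x ^ 2) * ∑ i : Fin 2, ∫ x, pderivE f i x ^ 2) := by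
      rw [integral_const_mul, integral_finsetSum _ fun i _ => (hf.partialDeriv i).sq.integrable]
      ring

/-- Two successive Young inequalities, with the weights used for the convection term. -/
lemma abs_le_of_sq_le_mul_of_sq_le_mul {I T L Y κ : ℝ} (hκ : 0 < κ) (hL : 0 ≤ L) (hY : 0 ≤ Y)
    (hI : I ^ 2 ≤ T * L) (hT : T ^ 2 ≤ 64 * Y * L) :
    |I| ≤ κ / 4 * L + 512 / κ ^ 3 * Y := by
  have hT' : T ≤ κ ^ 2 / 16 * L + 256 / κ ^ 2 * Y := by
    refine le_of_abs_le (abs_le_of_sq_le_sq ?_ (by positivity))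
    have h : 64 * Y * L = 4 * (κ ^ 2 / 16 * L) * (256 / κ ^ 2 * Y) := by field_simp; ring
    nlinarith [sq_nonneg (κ ^ 2 / 16 * L - 256 / κ ^ 2 * Y)]
  refine abs_le_of_sq_le_sq ?_ (by positivity)
  have h : κ / 4 * L + 512 / κ ^ 3 * Y =
      κ / 8 * L + 2 / κ * (κ ^ 2 / 16 * L + 256 / κ ^ 2 * Y) := by field_simp; ring
  rw [h]
  set S := κ ^ 2 / 16 * L + 256 / κ ^ 2 * Y
  have h' : S * L = 4 * (κ / 8 * L) * (2 / κ * S) := by field_simp; ring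
  nlinarith [sq_nonneg (κ / 8 * L - 2 / κ * S), mul_le_mul_of_nonneg_right hT' hL]

lemma sq_rpow_half {a : ℝ} (ha : 0 ≤ a) : (a ^ (1 / 2 : ℝ)) ^ 2 = a := by
  rw [← Real.sqrt_eq_rpow, Real.sq_sqrt ha]

lemma l2norm_sq (g : (Fin 2 → ℝ) → (Fin 2 → ℝ)) : l2norm g ^ 2 = ∫ x, ∑ k, g x k ^ 2 :=
  sq_rpow_half (integral_nonneg fun x => by positivity)

lemma gradNorm_sq (g : (Fin 2 → ℝ) → (Fin 2 → ℝ)) :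
    gradNorm g ^ 2 = ∫ x, ∑ i, ∑ k, pderivE (fun y => g y k) i x ^ 2 :=
  sq_rpow_half (integral_nonneg fun x => by positivity)

lemma lapNorm_sq (g : (Fin 2 → ℝ) → (Fin 2 → ℝ)) :
    lapNorm g ^ 2 = ∫ x, ∑ k, lapComp g k x ^ 2 :=
  sq_rpow_half (integral_nonneg fun x => by positivity)

/-- the uniqueness-proof estimate
`|⟨B̃(u₂,θ), Δθ⟩| ≤ κ‖Δθ‖₂² + C(κ)‖u₂‖₂²‖∇u₂‖₂²‖∇θ‖₂²`. -/
theorem convection_laplacian_estimate :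
    ∀ κ > (0:ℝ), ∃ C > (0:ℝ), ∀ u₂ θ : (Fin 2 → ℝ) → (Fin 2 → ℝ),
      ContDiff ℝ (⊤ : ℕ∞) u₂ → HasCompactSupport u₂ →
      ContDiff ℝ (⊤ : ℕ∞) θ → HasCompactSupport θ →
      |∑ i : Fin 2, ∑ k : Fin 2, ∫ x : Fin 2 → ℝ,
          u₂ x i * pderivE (fun y => θ y k) i x * lapComp θ k x| ≤
        κ * (lapNorm θ) ^ 2 + C * (l2norm u₂) ^ 2 * (gradNorm u₂) ^ 2 * (gradNorm θ) ^ 2 := by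
  intro κ hκ
  refine ⟨2048 / κ ^ 3, by positivity, fun u θ hu hu' hθ hθ' => ?_⟩
  have hU := IsTestFunction.component hu hu'
  have hΘ := IsTestFunction.component hθ hθ'
  have hLap : ∀ k, IsTestFunction (lapComp θ k) := fun k => by
    have h := (((hΘ k).partialDeriv 0).partialDeriv 0).add (((hΘ k).partialDeriv 1).partialDeriv 1)
    have h' : lapComp θ k = _ := funext fun x => Fin.sum_univ_two _
    rwa [h']
  have hu_le : ∀ i, ∫ x, u x i ^ 2 ≤ l2norm u ^ 2 := fun i => by
    rw [l2norm_sq, integral_finsetSum _ fun k _ => (hU k).sq.integrable]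
    exact Finset.single_le_sum (f := fun k => ∫ x, u x k ^ 2)
      (fun k _ => integral_nonneg fun x => sq_nonneg _) (Finset.mem_univ i)
  have hgrad_eq : ∀ v : (Fin 2 → ℝ) → (Fin 2 → ℝ), (∀ k, IsTestFunction fun x => v x k) →
      gradNorm v ^ 2 = ∑ k, ∑ i, ∫ x, pderivE (fun y => v y k) i x ^ 2 := fun v hv => by
    rw [gradNorm_sq, integral_finsetSum _ fun i _ =>
      integrable_finsetSum _ fun k _ => ((hv k).partialDeriv i).sq.integrable, Finset.sum_comm]
    exact Finset.sum_congr rfl fun i _ =>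
      integral_finsetSum _ fun k _ => ((hv k).partialDeriv i).sq.integrable
  have hgrad_le : ∀ v : (Fin 2 → ℝ) → (Fin 2 → ℝ), (∀ k, IsTestFunction fun x => v x k) →
      ∀ k, ∑ i, ∫ x, pderivE (fun y => v y k) i x ^ 2 ≤ gradNorm v ^ 2 := fun v hv k => by
    rw [hgrad_eq v hv]
    exact Finset.single_le_sum (f := fun k => ∑ i, ∫ x, pderivE (fun y => v y k) i x ^ 2)
      (fun k _ => Finset.sum_nonneg fun i _ => integral_nonneg fun x => sq_nonneg _)
      (Finset.mem_univ k)
  have hlap_le : ∀ k, ∫ x, lapComp θ k x ^ 2 ≤ lapNorm θ ^ 2 := fun k => by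
    rw [lapNorm_sq, integral_finsetSum _ fun k _ => (hLap k).sq.integrable]
    exact Finset.single_le_sum (f := fun k => ∫ x, lapComp θ k x ^ 2)
      (fun k _ => integral_nonneg fun x => sq_nonneg _) (Finset.mem_univ k)
  have hterm : ∀ i k, |∫ x, u x i * pderivE (fun y => θ y k) i x * lapComp θ k x| ≤
      κ / 4 * lapNorm θ ^ 2 +
        512 / κ ^ 3 * (l2norm u ^ 2 * gradNorm u ^ 2 * gradNorm θ ^ 2) := fun i k => by
    have hD := (hΘ k).partialDeriv i
    have hu4 : ∫ x, (u x i ^ 2) ^ 2 ≤ 8 * (l2norm u ^ 2 * gradNorm u ^ 2) := by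
      refine (hU i).integral_pow_four_le.trans ?_
      gcongr
      exacts [hu_le i, hgrad_le u hU i]
    have hd4 : ∫ x, (pderivE (fun y => θ y k) i x ^ 2) ^ 2 ≤
        8 * (gradNorm θ ^ 2 * lapNorm θ ^ 2) := by
      refine hD.integral_pow_four_le.trans ?_
      gcongr
      · exact (Finset.single_le_sum (f := fun i => ∫ x, pderivE (fun y => θ y k) i x ^ 2)
          (fun i _ => integral_nonneg fun x => sq_nonneg _) (Finset.mem_univ i)).trans
          (hgrad_le θ hΘ k)
      · refine le_trans ?_ (hlap_le k)
        refine le_of_le_of_eq ?_ (hΘ k).sum_integral_sq_pderivE_pderivE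
        exact Finset.single_le_sum
          (f := fun i => ∑ j, ∫ x, pderivE (pderivE (fun y => θ y k) i) j x ^ 2)
          (fun i _ => Finset.sum_nonneg fun j _ => integral_nonneg fun x => sq_nonneg _)
          (Finset.mem_univ i)
    refine abs_le_of_sq_le_mul_of_sq_le_mul
      (T := ∫ x, (u x i * pderivE (fun y => θ y k) i x) ^ 2) hκ (by positivity) (by positivity)
      ?_ ?_
    · refine (sq_integral_mul_le ((hU i).mul hD).sq.integrable (hLap k).sq.integrable
        (((hU i).mul hD).mul (hLap k)).integrable).trans ?_
      exact mul_le_mul_of_nonneg_left (hlap_le k) (integral_nonneg fun x => sq_nonneg _)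
    · simp only [mul_pow]
      refine (sq_integral_mul_le (hU i).sq.sq.integrable hD.sq.sq.integrable
        ((hU i).sq.mul hD.sq).integrable).trans ?_
      refine (mul_le_mul hu4 hd4 (integral_nonneg fun x => sq_nonneg _) (by positivity)).trans
        (le_of_eq ?_)
      ring
  calc |∑ i, ∑ k, ∫ x, u x i * pderivE (fun y => θ y k) i x * lapComp θ k x|
      ≤ ∑ i, ∑ k, |∫ x, u x i * pderivE (fun y => θ y k) i x * lapComp θ k x| :=
        (Finset.abs_sum_le_sum_abs _ _).trans
          (Finset.sum_le_sum fun i _ => Finset.abs_sum_le_sum_abs _ _)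
    _ ≤ ∑ _i : Fin 2, ∑ _k : Fin 2, (κ / 4 * lapNorm θ ^ 2 +
          512 / κ ^ 3 * (l2norm u ^ 2 * gradNorm u ^ 2 * gradNorm θ ^ 2)) :=
        Finset.sum_le_sum fun i _ => Finset.sum_le_sum fun k _ => hterm i k
    _ = κ * lapNorm θ ^ 2 + 2048 / κ ^ 3 * l2norm u ^ 2 * gradNorm u ^ 2 * gradNorm θ ^ 2 := by
        simp only [Fin.sum_univ_two]
        ring

end
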